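/- Let v : ℝ × ℝ → ℝ be a smooth function satisfying the mKdV equation v_t = v_xxx − 6 v² v_x at every point. Then the function u := −(v_x + v²) satisfies the KdV equation u_t = u_xxx + 6 u u_x at every point. -/

import Mathlib

/-- Partial derivative with respect to the first (space) variable. -/
noncomputable def px (f : ℝ × ℝ → ℝ) : ℝ × ℝ → ℝ :=
  fun p => deriv (fun x => f (x, p.2)) p.1

/-- Partial derivative with respect to the second (time) variable. -/
noncomputable def pt (f : ℝ × ℝ → ℝ) : ℝ × ℝ → ℝ :=
  fun p => deriv (fun t => f (p.1, t)) p.2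

open scoped ContDiff

theorem px_eq_fderiv {f : ℝ × ℝ → ℝ} (hf : Differentiable ℝ f) :
    px f = fun p => fderiv ℝ f p (1, 0) := by
  funext p
  have hline : HasDerivAt (fun x : ℝ => (x, p.2)) ((1 : ℝ), (0 : ℝ)) p.1 :=
    (hasDerivAt_id p.1).prodMk (hasDerivAt_const p.1 p.2)
  exact ((hf p).hasFDerivAt.comp_hasDerivAt p.1 hline).deriv

theorem pt_eq_fderiv {f : ℝ × ℝ → ℝ} (hf : Differentiable ℝ f) :
    pt f = fun p => fderiv ℝ f p (0, 1) := by
  funext p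
  have hline : HasDerivAt (fun t : ℝ => (p.1, t)) ((0 : ℝ), (1 : ℝ)) p.2 :=
    (hasDerivAt_const p.2 p.1).prodMk (hasDerivAt_id p.2)
  exact ((hf p).hasFDerivAt.comp_hasDerivAt p.2 hline).deriv

theorem contDiff_px {f : ℝ × ℝ → ℝ} (hf : ContDiff ℝ ∞ f) : ContDiff ℝ ∞ (px f) := by
  rw [px_eq_fderiv (hf.differentiable (by simp))]
  exact (hf.fderiv_right (by simp)).clm_apply contDiff_const

theorem hasDerivAt_px {f : ℝ × ℝ → ℝ} (hf : Differentiable ℝ f) (p : ℝ × ℝ) :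
    HasDerivAt (fun x => f (x, p.2)) (px f p) p.1 := by
  have h : Differentiable ℝ fun x : ℝ => f (x, p.2) := by fun_prop
  exact (h p.1).hasDerivAt

theorem hasDerivAt_pt {f : ℝ × ℝ → ℝ} (hf : Differentiable ℝ f) (p : ℝ × ℝ) :
    HasDerivAt (fun t => f (p.1, t)) (pt f p) p.2 := by
  have h : Differentiable ℝ fun t : ℝ => f (p.1, t) := by fun_prop
  exact (h p.2).hasDerivAt

/-- Mixed partial derivatives of a twice continuously differentiable function commute. -/
theorem pt_px_comm {f : ℝ × ℝ → ℝ} (hf : ContDiff ℝ 2 f) : pt (px f) = px (pt f) := by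
  have hd : Differentiable ℝ f := hf.differentiable (by simp)
  have hd' : Differentiable ℝ (fderiv ℝ f) :=
    (hf.fderiv_right (m := 1) (by norm_num)).differentiable (by simp)
  have happly (w : ℝ × ℝ) : Differentiable ℝ fun p => fderiv ℝ f p w :=
    hd'.clm_apply (differentiable_const w)
  rw [px_eq_fderiv hd, pt_eq_fderiv hd, pt_eq_fderiv (happly _), px_eq_fderiv (happly _)]
  funext p
  have hsymm : IsSymmSndFDerivAt ℝ f p := hf.contDiffAt.isSymmSndFDerivAt (by simp)
  simp only [fderiv_clm_apply (hd' p) (differentiableAt_const _), fderiv_fun_const]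
  simpa using hsymm.eq (0, 1) (1, 0)

/-- Miura transformation: if `v` is smooth and solves the mKdV equation
`v_t = v_xxx - 6 v² v_x`, then `u := -(v_x + v²)` solves the KdV equation
`u_t = u_xxx + 6 u u_x`. -/
theorem miura_mkdv_to_kdv
    (v : ℝ × ℝ → ℝ) (hv : ContDiff ℝ (⊤ : ℕ∞) v)
    (hmkdv : ∀ p, pt v p = px (px (px v)) p - 6 * (v p) ^ 2 * px v p) :
    ∀ p, pt (fun q => -(px v q + (v q) ^ 2)) p =
      px (px (px (fun q => -(px v q + (v q) ^ 2)))) p +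
        6 * (-(px v p + (v p) ^ 2)) * px (fun q => -(px v q + (v q) ^ 2)) p := by
  have h0 : Differentiable ℝ v := hv.differentiable (by simp)
  have hv1 := contDiff_px hv
  have hv2 := contDiff_px hv1
  have h1 : Differentiable ℝ (px v) := hv1.differentiable (by simp)
  have h2 : Differentiable ℝ (px (px v)) := hv2.differentiable (by simp)
  have h3 : Differentiable ℝ (px (px (px v))) := (contDiff_px hv2).differentiable (by simp)
  have hu1 : px (fun q => -(px v q + (v q) ^ 2)) =
      fun q => -(px (px v) q + 2 * v q * px v q) := by
    funext q
    refine (((hasDerivAt_px h1 q).add ((hasDerivAt_px h0 q).pow 2)).neg).deriv.trans ?_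
    norm_num
  have hu2 : px (fun q => -(px (px v) q + 2 * v q * px v q)) =
      fun q => -(px (px (px v)) q + 2 * px v q ^ 2 + 2 * v q * px (px v) q) := by
    funext q
    refine (((hasDerivAt_px h2 q).add
      (((hasDerivAt_px h0 q).const_mul 2).mul (hasDerivAt_px h1 q))).neg).deriv.trans ?_
    ring
  have hu3 : px (fun q => -(px (px (px v)) q + 2 * px v q ^ 2 + 2 * v q * px (px v) q)) =
      fun q => -(px (px (px (px v))) q + 6 * px v q * px (px v) q +
        2 * v q * px (px (px v)) q) := by
    funext q
    refine ((((hasDerivAt_px h3 q).add (((hasDerivAt_px h1 q).pow 2).const_mul 2)).add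
      (((hasDerivAt_px h0 q).const_mul 2).mul (hasDerivAt_px h2 q))).neg).deriv.trans ?_
    norm_num
    ring
  have hvxt : pt (px v) = fun q => px (px (px (px v))) q -
      (12 * v q * px v q ^ 2 + 6 * v q ^ 2 * px (px v) q) := by
    rw [pt_px_comm (contDiff_infty.1 hv 2), funext hmkdv]
    funext q
    refine ((hasDerivAt_px h3 q).sub
      ((((hasDerivAt_px h0 q).pow 2).const_mul 6).mul (hasDerivAt_px h1 q))).deriv.trans ?_
    norm_num
    ring
  intro p
  have hut : pt (fun q => -(px v q + (v q) ^ 2)) p = -(pt (px v) p + 2 * v p * pt v p) := by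
    refine (((hasDerivAt_pt h1 p).add ((hasDerivAt_pt h0 p).pow 2)).neg).deriv.trans ?_
    norm_num
  rw [hut, hu1, hu2, hu3, hvxt, hmkdv]
  ring
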